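/- Let R be a reduced ring and n ≥ 3. Then the matrix ring Mₙ(R) is a GWNC ring if and only if R is a Boolean ring. -/

import Mathlib

def IsWeaklyNilCleanElem {R : Type*} [Ring R] (a : R) : Prop :=
  ∃ e q : R, IsIdempotentElem e ∧ IsNilpotent q ∧ (a = q + e ∨ a = q - e)

def IsGWNCRing (R : Type*) [Ring R] : Prop :=
  ∀ a : R, ¬IsUnit a → IsWeaklyNilCleanElem a

/-- An element is nil-clean if it is the sum of a nilpotent and an idempotent. -/
def IsNilCleanElem {R : Type*} [Ring R] (a : R) : Prop :=
  ∃ e q : R, IsIdempotentElem e ∧ IsNilpotent q ∧ a = q + e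

theorem IsNilCleanElem.isWeaklyNilCleanElem {R : Type*} [Ring R] {a : R}
    (h : IsNilCleanElem a) : IsWeaklyNilCleanElem a := by
  obtain ⟨e, q, he, hq, h⟩ := h
  exact ⟨e, q, he, hq, Or.inl h⟩

theorem IsWeaklyNilCleanElem.isNilCleanElem_or_neg {R : Type*} [Ring R] {a : R}
    (h : IsWeaklyNilCleanElem a) : IsNilCleanElem a ∨ IsNilCleanElem (-a) := by
  obtain ⟨e, q, he, hq, h | h⟩ := h
  · exact Or.inl ⟨e, q, he, hq, h⟩
  · exact Or.inr ⟨e, -q, he, hq.neg, by rw [h]; abel⟩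

theorem IsNilCleanElem.map {R S : Type*} [Ring R] [Ring S] (f : R →+* S) {a : R}
    (h : IsNilCleanElem a) : IsNilCleanElem (f a) := by
  obtain ⟨e, q, he, hq, rfl⟩ := h
  exact ⟨f e, f q, he.map f, hq.map f, map_add f q e⟩

theorem mul_eq_zero_symm_of_isReduced {R : Type*} [Ring R] [IsReduced R] {x y : R}
    (h : x * y = 0) : y * x = 0 := by
  refine IsReduced.eq_zero _ ⟨2, ?_⟩
  rw [pow_two, mul_assoc, ← mul_assoc x, h, zero_mul, mul_zero]

theorem eq_zero_of_mul_self_of_isReduced {R : Type*} [Ring R] [IsReduced R] {x : R}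
    (h : x * x = 0) : x = 0 :=
  IsReduced.eq_zero _ ⟨2, by rw [pow_two, h]⟩

open Polynomial in
theorem isIdempotentElem_of_mul_quadratic_eq {R : Type*} [Ring R] [IsReduced R] {b d : R}
    {p : R[X]} (h : p * (1 + C b * X + C d * X ^ 2) = 1 + X) : IsIdempotentElem b := by
  have expand : p * (1 + C b * X + C d * X ^ 2) = p + p * C b * X + p * C d * X ^ 2 := by
    simp only [mul_add, mul_one, mul_assoc]
  rw [expand] at h
  have h0 : p.coeff 0 = 1 := by simpa [coeff_mul_X_pow'] using congrArg (coeff · 0) h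
  have h1 : p.coeff 1 + b = 1 := by
    have := congrArg (coeff · 1) h
    simpa [coeff_mul_X_pow', coeff_mul_X, coeff_one, h0] using this
  have hrec (k : ℕ) : p.coeff (k + 2) + p.coeff (k + 1) * b + p.coeff k * d = 0 := by
    have := congrArg (coeff · (k + 2)) h
    simpa [coeff_mul_X_pow', coeff_mul_X, coeff_one, coeff_X] using this
  have key (m k : ℕ) (hm : p.natDegree < k + m) :
      (p.coeff (k + 2) = 0 ∧ p.coeff (k + 1) * b = 0) ∧ p.coeff k * d = 0 := by
    induction m using Nat.strong_induction_on generalizing k with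
    | _ m ih =>
      by_cases hk : p.natDegree < k
      · simp [coeff_eq_zero_of_natDegree_lt hk,
          coeff_eq_zero_of_natDegree_lt (hk.trans (Nat.lt_add_of_pos_right Nat.one_pos)),
          coeff_eq_zero_of_natDegree_lt (hk.trans (Nat.lt_add_of_pos_right Nat.two_pos))]
      obtain ⟨⟨-, hb⟩, hd⟩ := ih (m - 1) (by omega) (k + 1) (by omega)
      have hd' : p.coeff (k + 2) * d = 0 := by
        by_cases hm : m = 1
        · simp [coeff_eq_zero_of_natDegree_lt (show p.natDegree < k + 2 by omega)]
        · exact (ih (m - 2) (by omega) (k + 2) (by omega)).2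
      have hk2 : p.coeff (k + 2) = 0 := by
        apply eq_zero_of_mul_self_of_isReduced
        simpa [add_mul, mul_assoc, mul_eq_zero_symm_of_isReduced hb,
          mul_eq_zero_symm_of_isReduced hd'] using congrArg (· * p.coeff (k + 2)) (hrec k)
      have hk1 : p.coeff (k + 1) * b = 0 := by
        apply eq_zero_of_mul_self_of_isReduced
        have : p.coeff (k + 1) * (b * p.coeff (k + 1)) = 0 := by
          simpa [hk2, add_mul, mul_assoc, mul_eq_zero_symm_of_isReduced hd]
            using congrArg (· * p.coeff (k + 1)) (hrec k)
        rw [← mul_assoc, mul_assoc _ b, this, zero_mul]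
      exact ⟨⟨hk2, hk1⟩, by simpa [hk2, hk1] using hrec k⟩
  have := (key (p.natDegree + 1) 0 (by omega)).1.2
  rw [zero_add, eq_sub_of_add_eq h1, sub_mul, one_mul, sub_eq_zero] at this
  exact this.symm

theorem Matrix.not_isUnit_of_row_eq_zero {R n : Type*} [Ring R] [Nontrivial R] [Fintype n]
    [DecidableEq n] {A : Matrix n n R} {i : n} (h : ∀ j, A i j = 0) : ¬IsUnit A := by
  rintro hA
  obtain ⟨B, hB⟩ := hA.exists_right_inv
  have := congrFun (congrFun hB i) i
  simp [Matrix.mul_apply, h] at this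

open Polynomial in
/-- Inverting `1 - X q` over `R[X]` and taking the `(i, i)` entry gives a factorization of `1 + X`
with a quadratic factor whose linear coefficient is `1 - a`. -/
theorem isIdempotentElem_of_isNilCleanElem_single {R n : Type*} [Ring R] [IsReduced R] [Fintype n]
    [DecidableEq n] {i : n} {a : R} (h : IsNilCleanElem (Matrix.single i i a)) :
    IsIdempotentElem a := by
  obtain ⟨e, q, he, hq, h⟩ := h
  let ι : Matrix n n R →+* Matrix n n R[X] := C.mapMatrix
  let s : Matrix n n R[X] := Matrix.scalar n X
  have hs (M : Matrix n n R[X]) : Commute s M :=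
    Matrix.scalar_commute X (fun r => commute_X r) M
  obtain ⟨u, hu⟩ := ((hs (ι q)).isNilpotent_mul_left (hq.map ι)).isUnit_one_sub.exists_left_inv
  have hA : ι (Matrix.single i i a) = ι q + ι e := by rw [h, map_add]
  have he' : ι e * ι e = ι e := he.map ι
  have hes : s * ι e * (1 + s - s * ι e) = s * ι e := by
    simp only [mul_add, mul_sub, mul_one, mul_assoc]
    rw [← mul_assoc (ι e) s (ι e), ← (hs (ι e)).eq, mul_assoc, he']
    abel
  have hM : (1 + s * ι e) * u * (1 + s - s * ι (Matrix.single i i a) * (1 + s - s * ι e))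
      = 1 + s := by
    have hfac : 1 + s - s * ι (Matrix.single i i a) * (1 + s - s * ι e) =
        (1 - s * ι q) * (1 + s - s * ι e) := by
      rw [hA, mul_add, add_mul, hes, sub_mul, one_mul]
      abel
    rw [hfac, mul_assoc, ← mul_assoc u, hu, one_mul, add_mul, one_mul, hes]
    abel
  have hentry := congrFun (congrFun hM i) i
  rw [Matrix.mul_apply, Finset.sum_eq_single i] at hentry
  · have hcorner : (1 + s - s * ι (Matrix.single i i a) * (1 + s - s * ι e)) i i =
        1 + C (1 - a) * X + C (-(a * (1 - e i i))) * X ^ 2 := by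
      simp [s, ι, mul_assoc, Matrix.single_mul_apply_same, Matrix.map_single]
      rw [X_mul]
      simp only [mul_add, mul_sub, add_mul, sub_mul, mul_one, one_mul, mul_assoc, pow_two]
      abel
    rw [hcorner] at hentry
    have := isIdempotentElem_of_mul_quadratic_eq (hentry.trans (by simp [s]))
    simpa using this.one_sub
  · intro k _ hk
    simp [s, ι, mul_assoc, Matrix.single_mul_apply_of_ne, hk, Matrix.map_single]
  · simp

theorem Matrix.trace_eq_rank_of_isIdempotentElem {F n : Type*} [Field F] [Fintype n]
    [DecidableEq n] {e : Matrix n n F} (he : IsIdempotentElem e) : e.trace = (e.rank : F) := by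
  have he' : IsIdempotentElem (Matrix.toLin' e) := he.map (Matrix.toLinAlgEquiv' (R := F) (n := n))
  rw [← Matrix.trace_toLin'_eq, (LinearMap.IsIdempotentElem.isProj_range _ he').trace]
  rfl

theorem Matrix.rank_le_of_isNilpotent_sub {F n : Type*} [Field F] [Fintype n]
    [DecidableEq n] {A e : Matrix n n F} (he : IsIdempotentElem e) (h : IsNilpotent (A - e)) :
    e.rank ≤ A.rank := by
  obtain ⟨u, hu⟩ := h.isUnit_one_add.exists_left_inv
  have : e = u * (A * e) := by
    have h1 : (1 + (A - e)) * e = A * e := by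
      rw [add_mul, sub_mul, he.eq, one_mul]; abel
    rw [← h1, ← mul_assoc, hu, one_mul]
  calc e.rank = (u * (A * e)).rank := by rw [← this]
    _ ≤ (A * e).rank := Matrix.rank_mul_le_right _ _
    _ ≤ A.rank := Matrix.rank_mul_le_left _ _

theorem IsNilCleanElem.isNilpotent_of_trace_eq_zero {F n : Type*} [Field F] {p : ℕ} [CharP F p]
    [Fintype n] [DecidableEq n] {A : Matrix n n F} (h : IsNilCleanElem A) (htr : A.trace = 0)
    (hrank : A.rank < p) : IsNilpotent A := by
  obtain ⟨e, q, he, hq, rfl⟩ := h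
  have hle := Matrix.rank_le_of_isNilpotent_sub (A := q + e) he (by simpa using hq)
  rw [Matrix.trace_add, (Matrix.isNilpotent_trace_of_isNilpotent hq).eq_zero, zero_add,
    Matrix.trace_eq_rank_of_isIdempotentElem he, CharP.cast_eq_zero_iff F p] at htr
  have he0 : e = 0 := by
    apply (Matrix.toLin' (R := F)).injective
    rw [map_zero, ← LinearMap.range_eq_bot, ← Submodule.finrank_eq_zero (R := F)]
    exact Nat.eq_zero_of_dvd_of_lt htr (hle.trans_lt hrank)
  simpa [he0] using hq

theorem not_isNilCleanElem_diagonal {F n : Type*} [Field F] [CharP F 3] [Fintype n] [DecidableEq n]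
    {i j : n} (hij : i ≠ j) {a : F} (ha : a ≠ 0) :
    ¬IsNilCleanElem (Matrix.diagonal (Pi.single i a - Pi.single j a) : Matrix n n F) := by
  classical
  intro h
  have htr : (Matrix.diagonal (Pi.single i a - Pi.single j a) : Matrix n n F).trace = 0 := by
    simp [Matrix.trace_diagonal]
  have hrank : (Matrix.diagonal (Pi.single i a - Pi.single j a) : Matrix n n F).rank < 3 := by
    rw [Matrix.rank_diagonal, Fintype.card_subtype]
    refine lt_of_le_of_lt (Finset.card_le_card (t := {i, j}) fun k hk => ?_)
      (Finset.card_le_two.trans_lt (by norm_num))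
    by_contra hne
    simp only [Finset.mem_insert, Finset.mem_singleton, not_or] at hne
    simp [hne.1, hne.2] at hk
  obtain ⟨k, hk⟩ := h.isNilpotent_of_trace_eq_zero htr hrank
  rw [Matrix.diagonal_pow] at hk
  have := congrFun (congrFun hk i) i
  simp [hij, ha] at this

theorem two_eq_zero_of_isGWNCRing_matrix {R n : Type*} [CommRing R] [IsReduced R] [Fintype n]
    [DecidableEq n] (h6 : (6 : R) = 0) {i j k : n} (hij : i ≠ j) (hik : i ≠ k) (hjk : j ≠ k)
    (h : IsGWNCRing (Matrix n n R)) : (2 : R) = 0 := by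
  by_contra h2
  have : Nontrivial R := ⟨2, 0, h2⟩
  obtain ⟨P, hP, h2P⟩ : ∃ P : Ideal R, P.IsPrime ∧ (2 : R) ∉ P := by
    by_contra! hall
    exact h2 (nilpotent_iff_mem_prime.2 hall).eq_zero
  let φ : R →+* FractionRing (R ⧸ P) := (algebraMap (R ⧸ P) _).comp (Ideal.Quotient.mk P)
  have hφ2 : (2 : FractionRing (R ⧸ P)) ≠ 0 := by
    intro h0
    apply h2P
    rw [← Ideal.Quotient.eq_zero_iff_mem]
    apply IsFractionRing.injective (R ⧸ P) (FractionRing (R ⧸ P))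
    rwa [map_ofNat, map_ofNat, map_zero]
  have hφ3 : (3 : FractionRing (R ⧸ P)) = 0 := by
    have h0 : (2 : FractionRing (R ⧸ P)) * 3 = 0 := by
      have := congrArg φ h6
      rw [map_ofNat, map_zero] at this
      rw [← this]; norm_num
    exact (mul_eq_zero.1 h0).resolve_left hφ2
  have : CharP (FractionRing (R ⧸ P)) 3 :=
    (CharP.charP_iff_prime_eq_zero Nat.prime_three).2 (mod_cast hφ3)
  have hmap (x y : n)
      (hxy : IsNilCleanElem (Matrix.diagonal (Pi.single x 1 - Pi.single y 1) : Matrix n n R)) :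
      IsNilCleanElem (Matrix.diagonal (Pi.single x 1 - Pi.single y 1) :
        Matrix n n (FractionRing (R ⧸ P))) := by
    convert hxy.map φ.mapMatrix
    ext z w
    simp [Matrix.diagonal_apply, apply_ite φ, Pi.single_apply]
  have hA := h (Matrix.diagonal (Pi.single i 1 - Pi.single j 1))
    (Matrix.not_isUnit_of_row_eq_zero (i := k) fun l => by
      simp [Matrix.diagonal_apply, hik.symm, hjk.symm])
  rcases hA.isNilCleanElem_or_neg with hA | hA
  · exact not_isNilCleanElem_diagonal hij one_ne_zero (hmap i j hA)
  · have hneg : -(Matrix.diagonal (Pi.single i 1 - Pi.single j 1) : Matrix n n R) =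
        Matrix.diagonal (Pi.single j 1 - Pi.single i 1) := by
      rw [Matrix.diagonal_neg]
      exact congrArg Matrix.diagonal (neg_sub _ _)
    rw [hneg] at hA
    exact not_isNilCleanElem_diagonal hij.symm one_ne_zero (hmap j i hA)

theorem commute_of_isIdempotentElem_of_isReduced {R : Type*} [Ring R] [IsReduced R] {e : R}
    (he : IsIdempotentElem e) (x : R) : Commute e x := by
  have h1 : e * (x * (1 - e)) = 0 := by
    have := mul_eq_zero_symm_of_isReduced (x := x * (1 - e)) (y := e)
      (by rw [mul_assoc, he.one_sub_mul_self, mul_zero])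
    exact this
  have h2 : (1 - e) * x * e = 0 :=
    mul_eq_zero_symm_of_isReduced (by rw [← mul_assoc, he.mul_one_sub_self, zero_mul])
  rw [mul_sub, mul_one, mul_sub, sub_eq_zero] at h1
  rw [sub_mul, sub_mul, one_mul, sub_eq_zero] at h2
  exact h1.trans ((mul_assoc _ _ _).symm.trans h2.symm)

theorem isIdempotentElem_of_isGWNCRing_matrix {R n : Type*} [Ring R] [IsReduced R] [Fintype n]
    [DecidableEq n] {i j k : n} (hij : i ≠ j) (hik : i ≠ k) (hjk : j ≠ k)
    (h : IsGWNCRing (Matrix n n R)) (a : R) : IsIdempotentElem a := by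
  nontriviality R
  have hsq (a : R) : IsIdempotentElem a ∨ IsIdempotentElem (-a) := by
    have hA := h (Matrix.single i i a) (Matrix.not_isUnit_of_row_eq_zero (i := j) fun l => by
      simp [hij])
    rcases hA.isNilCleanElem_or_neg with hA | hA
    · exact .inl (isIdempotentElem_of_isNilCleanElem_single hA)
    · exact .inr (isIdempotentElem_of_isNilCleanElem_single (by simpa [Matrix.single_neg] using hA))
  have hcomm (x y : R) : x * y = y * x := by
    rcases hsq x with hx | hx
    · exact commute_of_isIdempotentElem_of_isReduced hx y
    · exact Commute.neg_left_iff.1 (commute_of_isIdempotentElem_of_isReduced hx y)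
  have h2 : (2 : R) = 0 := by
    have h6 : (6 : R) = 0 := by
      rcases hsq 2 with h2 | h2
      · have : (2 : R) * 2 - 2 = 0 := sub_eq_zero.2 h2
        calc (6 : R) = 3 * (2 * 2 - 2) := by norm_num
          _ = 0 := by rw [this, mul_zero]
      · have : (-2 : R) * -2 - -2 = 0 := sub_eq_zero.2 h2
        calc (6 : R) = -2 * -2 - -2 := by norm_num
          _ = 0 := this
    let _ : CommRing R := { ‹Ring R› with mul_comm := hcomm }
    exact two_eq_zero_of_isGWNCRing_matrix h6 hij hik hjk h
  have hneg : -a = a := by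
    rw [neg_eq_iff_add_eq_zero, ← two_mul, h2, zero_mul]
  rcases hsq a with ha | ha
  · exact ha
  · rwa [hneg] at ha

theorem isNilpotent_of_basis_mem_maxGenEigenspace {K V ι : Type*} [Field K] [AddCommGroup V]
    [Module K V] [FiniteDimensional K V] (b : Module.Basis ι K V) {q : Module.End K V}
    (h : ∀ i, b i ∈ q.maxGenEigenspace 0) : IsNilpotent q := by
  rw [Module.End.isNilpotent_iff_of_finite]
  intro x
  have htop : q.maxGenEigenspace 0 = ⊤ := by
    rw [eq_top_iff, ← b.span_eq, Submodule.span_le]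
    rintro _ ⟨i, rfl⟩
    exact h i
  have hx : x ∈ q.maxGenEigenspace 0 := htop ▸ Submodule.mem_top
  simpa only [Module.End.mem_maxGenEigenspace, zero_smul, sub_zero] using hx

theorem mem_maxGenEigenspace_zero_of_apply_mem {K V : Type*} [Field K] [AddCommGroup V]
    [Module K V] {q : Module.End K V} {x : V} (h : q x ∈ q.maxGenEigenspace 0) :
    x ∈ q.maxGenEigenspace 0 := by
  simp only [Module.End.mem_maxGenEigenspace, zero_smul, sub_zero] at h ⊢
  obtain ⟨k, hk⟩ := h
  exact ⟨k + 1, by rw [pow_succ, Module.End.mul_apply, hk]⟩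

/-- If `v n` has leading term `v m` in the cyclic basis, the idempotent kills `v i` for `i < m`,
sends `v i` to `v m` for `m ≤ i < n - 1`, and sends `v (n - 1)` to `v m + v n + v (n - 1)`. -/
theorem isNilCleanElem_of_cyclic_basis {V : Type*} [AddCommGroup V] [Module (ZMod 2) V] {n : ℕ}
    (b : Module.Basis (Fin n) (ZMod 2) V) (f : Module.End (ZMod 2) V) (v : ℕ → V)
    (hb : ∀ i, b i = v i) (hv : ∀ i, f (v i) = v (i + 1)) : IsNilCleanElem f := by
  have : FiniteDimensional (ZMod 2) V := b.finiteDimensional_of_finite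
  by_cases hn : v n = 0
  · refine ⟨0, f, .zero, isNilpotent_of_basis_mem_maxGenEigenspace b fun i => ?_, (add_zero f).symm⟩
    rw [hb]
    refine Nat.decreasingInduction (motive := fun k _ => v k ∈ f.maxGenEigenspace 0)
      (fun k _ hk => mem_maxGenEigenspace_zero_of_apply_mem (hv k ▸ hk)) (by simp [hn]) i.2.le
  obtain ⟨m, hm1, hmax⟩ : ∃ m : Fin n, b.repr (v n) m = 1 ∧ ∀ j, m < j → b.repr (v n) j = 0 := by
    have hne : (b.repr (v n)).support.Nonempty := by simpa using hn
    refine ⟨_, Fin.eq_one_of_ne_zero _ (Finsupp.mem_support_iff.1 (Finset.max'_mem _ hne)),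
      fun j hj => ?_⟩
    by_contra hj0
    exact (Finset.le_max' _ j (Finsupp.mem_support_iff.2 hj0)).not_gt hj
  let E : ℕ → V := fun i =>
    if i < m then 0 else if i + 1 < n then v m else v m + v n + v (n - 1)
  let e : Module.End (ZMod 2) V := b.constr (ZMod 2) fun i => E i
  have he (i : ℕ) (hi : i < n) : e (v i) = E i := by
    rw [← hb ⟨i, hi⟩]
    exact b.constr_basis (ZMod 2) (fun i : Fin n => E i) ⟨i, hi⟩
  have hm := m.2
  have htwo (x : V) : x + x = 0 := ZModModule.add_self x
  have hen : e (v n) = e (v m) := by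
    conv_lhs => rw [← b.sum_repr (v n), map_sum]
    rw [Finset.sum_eq_single m]
    · rw [hm1, one_smul, hb]
    · intro j _ hj
      rcases lt_or_gt_of_ne hj with hj | hj
      · rw [map_smul, hb, he j j.2]
        simp [E, hj]
      · rw [hmax j hj, zero_smul, map_zero]
    · simp
  have hidem : IsIdempotentElem e := by
    refine b.ext fun i => ?_
    rw [Module.End.mul_apply, hb, he i i.2]
    have hi := i.2
    by_cases h1 : (i : ℕ) < m
    · simp [E, h1]
    by_cases h2 : (i : ℕ) + 1 < n
    · have h3 : (m : ℕ) + 1 < n := by omega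
      simp only [E, h1, h2, if_true, if_false]
      rw [he m hm]
      simp [E, h3]
    · have hlast : n - 1 = i := by omega
      simp only [E, h1, h2, if_false, map_add]
      rw [hen, htwo, zero_add, he _ (by omega), hlast]
      simp [E, h1, h2, hlast]
  refine ⟨e, f - e, hidem, ?_, (sub_add_cancel f e).symm⟩
  let S := (f - e).maxGenEigenspace 0
  have hS {x : V} : (f - e) x ∈ S → x ∈ S := mem_maxGenEigenspace_zero_of_apply_mem
  have hlt (i : ℕ) (hi : i < m) : (f - e) (v i) = v (i + 1) := by
    rw [LinearMap.sub_apply, hv, he i (by omega)]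
    simp [E, hi]
  have hge (i : ℕ) (hmi : m ≤ i) (hi : i + 1 < n) : (f - e) (v i) = v (i + 1) + v m := by
    rw [LinearMap.sub_apply, hv, he i (by omega), ZModModule.sub_eq_add]
    simp [E, hi, hmi.not_gt]
  have hlast : (f - e) (v (n - 1)) = v (n - 1) + v m := by
    rw [LinearMap.sub_apply, hv, he _ (by omega), ZModModule.sub_eq_add]
    have h1 : ¬ n - 1 < (m : ℕ) := by omega
    have h2 : n - 1 + 1 = n := by omega
    simp only [E, h1, h2, if_false, lt_irrefl]
    linear_combination (norm := module) htwo (v n)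
  have hdiff (i : ℕ) (hi : i + 1 ≤ n - 1) : m ≤ i → v i + v (i + 1) ∈ S := by
    obtain ⟨j, hj⟩ := Nat.exists_eq_add_of_le hi
    induction j generalizing i with
    | zero =>
      intro hmi
      apply hS
      rw [map_add, hge i hmi (by omega), show i + 1 = n - 1 by omega, hlast, ZModModule.add_self]
      exact S.zero_mem
    | succ j ih =>
      intro hmi
      apply hS
      rw [map_add, hge i hmi (by omega), hge (i + 1) (by omega) (by omega)]
      have hnext := ih (i + 1) (by omega) (by omega) (by omega)
      convert hnext using 1
      linear_combination (norm := module) htwo (v m)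
  have hvm : v m ∈ S := by
    apply hS
    by_cases h : (m : ℕ) + 1 < n
    · rw [hge m le_rfl h, add_comm]
      exact hdiff m (by omega) le_rfl
    · have hmn : n - 1 = m := by omega
      rw [hmn] at hlast
      rw [hlast, htwo]
      exact S.zero_mem
  apply isNilpotent_of_basis_mem_maxGenEigenspace b
  intro i
  rw [hb]
  rcases le_total (i : ℕ) m with him | him
  · exact Nat.decreasingInduction (motive := fun k _ => v k ∈ S)
      (fun k hk hk' => hS (hlt k hk ▸ hk')) hvm him
  · have hi := i.2
    generalize (i : ℕ) = k at him hi
    induction k, him using Nat.le_induction with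
    | base => exact hvm
    | succ k hk ih =>
      exact (S.add_mem_iff_right (ih (by omega))).1 (hdiff k (by omega) hk)

/-- A block triangular endomorphism with nil-clean diagonal blocks is nil-clean. -/
theorem isNilCleanElem_prod {K W U : Type*} [Field K] [AddCommGroup W] [Module K W]
    [AddCommGroup U] [Module K U] {f : Module.End K (W × U)} (hf : ∀ w, (f (w, 0)).2 = 0)
    (hW : IsNilCleanElem (LinearMap.fst K W U ∘ₗ f ∘ₗ LinearMap.inl K W U : Module.End K W))
    (hU : IsNilCleanElem (LinearMap.snd K W U ∘ₗ f ∘ₗ LinearMap.inr K W U : Module.End K U)) :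
    IsNilCleanElem f := by
  obtain ⟨e₁, q₁, he₁, ⟨k, hk⟩, h₁⟩ := hW
  obtain ⟨e₂, q₂, he₂, ⟨l, hl⟩, h₂⟩ := hU
  let e : Module.End K (W × U) := LinearMap.prodMap e₁ e₂
  have hfW (w : W) : (f (w, 0)).1 = q₁ w + e₁ w := LinearMap.congr_fun h₁ w
  have hfU (u : U) : (f (0, u)).2 = q₂ u + e₂ u := LinearMap.congr_fun h₂ u
  have hqW (w : W) : (f - e) (w, 0) = (q₁ w, 0) := by
    ext <;> simp [e, hfW, hf]
  have hqU (x : W × U) : ((f - e) x).2 = q₂ x.2 := by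
    have hx : f x = f (x.1, 0) + f (0, x.2) := by rw [← map_add]; simp
    simp [e, hx, hf, hfU]
  have hpowW (j : ℕ) (w : W) : ((f - e) ^ j) (w, 0) = ((q₁ ^ j) w, 0) := by
    induction j with
    | zero => simp
    | succ j ih => rw [pow_succ', Module.End.mul_apply, ih, hqW, pow_succ', Module.End.mul_apply]
  have hpowU (j : ℕ) (x : W × U) : (((f - e) ^ j) x).2 = (q₂ ^ j) x.2 := by
    induction j with
    | zero => simp
    | succ j ih => rw [pow_succ', Module.End.mul_apply, hqU, ih, pow_succ', Module.End.mul_apply]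
  refine ⟨e, f - e, ?_, ⟨k + l, ?_⟩, (sub_add_cancel f e).symm⟩
  · change LinearMap.prodMap e₁ e₂ * LinearMap.prodMap e₁ e₂ = LinearMap.prodMap e₁ e₂
    rw [LinearMap.prodMap_mul, he₁.eq, he₂.eq]
  · refine LinearMap.ext fun x => ?_
    have hx : ((f - e) ^ l) x = ((((f - e) ^ l) x).1, 0) := by
      ext
      · rfl
      · rw [hpowU, hl, LinearMap.zero_apply]
    rw [pow_add, Module.End.mul_apply, hx, hpowW, hk]
    rfl

theorem exists_cyclic_basis {K V : Type*} [Field K] [AddCommGroup V] [Module K V]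
    [FiniteDimensional K V] (f : Module.End K V) {x : V} (hx : x ≠ 0)
    (hf : ∀ W : Submodule K V, W ≠ ⊥ → (∀ w ∈ W, f w ∈ W) → W = ⊤) :
    ∃ (n : ℕ) (b : Module.Basis (Fin n) K V), ∀ i, b i = (f ^ (i : ℕ)) x := by
  classical
  have hex : ∃ k : ℕ, ¬LinearIndependent K (fun i : Fin k => (f ^ (i : ℕ)) x) :=
    ⟨Module.finrank K V + 1, fun h => by simpa using h.fintype_card_le_finrank⟩
  obtain ⟨n, hn⟩ : ∃ n, Nat.find hex = n + 1 := by
    refine Nat.exists_eq_succ_of_ne_zero fun h0 => ?_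
    have := Nat.find_spec hex
    rw [h0] at this
    exact this (linearIndependent_empty_type)
  have hli : LinearIndependent K (fun i : Fin n => (f ^ (i : ℕ)) x) :=
    not_not.1 (Nat.find_min hex (by omega))
  have hnot := Nat.find_spec hex
  rw [hn, linearIndependent_finSucc'] at hnot
  have hmem : (f ^ n) x ∈ Submodule.span K (Set.range fun i : Fin n => (f ^ (i : ℕ)) x) := by
    by_contra hmem
    exact hnot ⟨hli, by simpa [Fin.init_def] using hmem⟩
  refine ⟨n, Module.Basis.mk hli (hf _ ?_ ?_).ge, fun i => by simp⟩
  · intro hbot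
    rw [hbot, Submodule.mem_bot] at hmem
    rcases Nat.eq_zero_or_pos n with rfl | hpos
    · exact hx (by simpa using hmem)
    · have : (f ^ 0) x ∈ Submodule.span K (Set.range fun i : Fin n => (f ^ (i : ℕ)) x) :=
        Submodule.subset_span ⟨⟨0, hpos⟩, rfl⟩
      rw [hbot, Submodule.mem_bot] at this
      exact hx (by simpa using this)
  · intro w hw
    induction hw using Submodule.span_induction with
    | mem y hy =>
      obtain ⟨i, rfl⟩ := hy
      change f ((f ^ (i : ℕ)) x) ∈ _
      rw [← Module.End.mul_apply, ← pow_succ']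
      rcases Nat.lt_or_ge (i + 1) n with hi | hi
      · exact Submodule.subset_span ⟨⟨i + 1, hi⟩, rfl⟩
      · rwa [show (i : ℕ) + 1 = n by omega]
    | zero => simp
    | add y z _ _ hy hz => rw [map_add]; exact Submodule.add_mem _ hy hz
    | smul c y _ hy => rw [map_smul]; exact Submodule.smul_mem _ c hy

theorem isNilCleanElem_end_zmod_two {V : Type*} [AddCommGroup V] [Module (ZMod 2) V]
    [FiniteDimensional (ZMod 2) V] (f : Module.End (ZMod 2) V) : IsNilCleanElem f := by
  induction hd : Module.finrank (ZMod 2) V using Nat.strong_induction_on generalizing V with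
  | _ d ih =>
    by_cases hf : ∀ W : Submodule (ZMod 2) V, W ≠ ⊥ → (∀ w ∈ W, f w ∈ W) → W = ⊤
    · rcases subsingleton_or_nontrivial V with _ | _
      · exact ⟨0, 0, .zero, .zero, Subsingleton.elim _ _⟩
      · obtain ⟨x, hx⟩ := exists_ne (0 : V)
        obtain ⟨n, b, hb⟩ := exists_cyclic_basis f hx hf
        exact isNilCleanElem_of_cyclic_basis b f (fun i => (f ^ i) x) hb fun i => by
          rw [pow_succ', Module.End.mul_apply]
    · push Not at hf
      obtain ⟨W, hbot, hW, htop⟩ := hf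
      obtain ⟨U, hU⟩ := W.exists_isCompl
      let φ := W.prodEquivOfIsCompl U hU
      have hlt : Module.finrank (ZMod 2) W < d := hd ▸ Submodule.finrank_lt htop
      have hpos : 0 < Module.finrank (ZMod 2) W :=
        Nat.pos_of_ne_zero fun h => hbot (Submodule.finrank_eq_zero.1 h)
      have hsum := Submodule.finrank_add_eq_of_isCompl hU
      have hnc : IsNilCleanElem (φ.conjRingEquiv.symm f) := by
        refine isNilCleanElem_prod (fun w => ?_) (ih _ hlt _ rfl) (ih _ (by omega) _ rfl)
        simpa [φ] using hW w w.2
      simpa using hnc.map φ.conjRingEquiv.toRingHom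

theorem isNilCleanElem_matrix_zmod_two {n : Type*} [Fintype n] [DecidableEq n]
    (A : Matrix n n (ZMod 2)) : IsNilCleanElem A := by
  simpa using (isNilCleanElem_end_zmod_two (Matrix.toLinAlgEquiv' A)).map
    (Matrix.toLinAlgEquiv' (R := ZMod 2) (n := n)).symm.toRingEquiv.toRingHom

/-- The ring of Boolean functions on `ι → ZMod 2` is the free Boolean ring on the coordinates. -/
theorem BooleanRing.exists_ringHom_apply_eval {R ι : Type*} [BooleanRing R] [Fintype ι]
    (x : ι → R) : ∃ ψ : ((ι → ZMod 2) → ZMod 2) →+* R, ∀ i, ψ (fun B => B i) = x i := by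
  classical
  have hchar : ringChar R ∣ 2 := by
    rw [← ringChar.spec]
    exact_mod_cast (one_add_one_eq_two (R := R)) ▸ BooleanRing.add_self (1 : R)
  let κ : ZMod 2 →+* R := ZMod.castHom hchar R
  let δ : (ι → ZMod 2) → R := fun B => ∏ i, (x i + κ (B i) + 1)
  have hδ (B : ι → ZMod 2) (i : ι) : δ B * κ (B i) = δ B * x i := by
    have h0 : δ B * (κ (B i) + x i) = 0 := by
      change (∏ i, (x i + κ (B i) + 1)) * _ = 0
      rw [← Finset.prod_erase_mul _ _ (Finset.mem_univ i), mul_assoc, add_comm (x i), add_comm _ 1,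
        mul_comm (1 + _), BooleanRing.mul_one_add_self, mul_zero]
    rwa [mul_add, BooleanRing.add_eq_zero'] at h0
  have hsum : ∑ B, δ B = 1 := by
    have hfactor (i : ι) : ∑ b : ZMod 2, (x i + κ b + 1) = 1 := by
      rw [show (Finset.univ : Finset (ZMod 2)) = {0, 1} from rfl, Finset.sum_pair zero_ne_one,
        map_zero, map_one, add_zero, add_assoc (x i) 1 1, BooleanRing.add_self, add_zero,
        add_right_comm, BooleanRing.add_self, zero_add]
    calc ∑ B, δ B = ∏ i, ∑ b : ZMod 2, (x i + κ b + 1) := by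
          rw [Finset.prod_univ_sum, Fintype.piFinset_univ]
      _ = 1 := by simp [hfactor]
  have horth (B C : ι → ZMod 2) (hBC : C ≠ B) : δ B * δ C = 0 := by
    obtain ⟨i, hi⟩ := Function.ne_iff.1 hBC
    have h1 : δ B * δ C * κ (B i) = δ B * δ C * κ (C i) := by
      rw [mul_right_comm, hδ, mul_assoc _ (δ C), hδ, mul_right_comm, mul_assoc]
    have h2 : B i - C i = 1 := Fin.eq_one_of_ne_zero _ (sub_ne_zero.2 hi.symm)
    rw [← sub_eq_zero, ← mul_sub, ← map_sub, h2, map_one, mul_one] at h1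
    exact h1
  refine ⟨{ toFun := fun f => ∑ B, δ B * κ (f B)
            map_zero' := by simp
            map_one' := by simpa using hsum
            map_add' := fun f g => by simp [mul_add, Finset.sum_add_distrib]
            map_mul' := fun f g => ?_ }, fun i => ?_⟩
  · rw [Finset.sum_mul_sum]
    refine Finset.sum_congr rfl fun B _ => ?_
    rw [Finset.sum_eq_single B]
    · rw [mul_mul_mul_comm, BooleanRing.mul_self, Pi.mul_apply, map_mul]
    · intro C _ hC
      rw [mul_mul_mul_comm, horth B C hC, zero_mul]
    · simp
  · change ∑ B, δ B * κ (B i) = x i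
    simp_rw [hδ, ← Finset.sum_mul, hsum, one_mul]

theorem BooleanRing.isNilCleanElem_matrix {R n : Type*} [BooleanRing R] [Fintype n]
    [DecidableEq n] (A : Matrix n n R) : IsNilCleanElem A := by
  obtain ⟨ψ, hψ⟩ := BooleanRing.exists_ringHom_apply_eval fun ij : n × n => A ij.1 ij.2
  choose e q he hq h using fun B : n × n → ZMod 2 =>
    isNilCleanElem_matrix_zmod_two (Matrix.of fun i j => B (i, j))
  choose k hk using hq
  let e' : Matrix n n ((n × n → ZMod 2) → ZMod 2) := Matrix.of fun i j B => e B i j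
  let q' : Matrix n n ((n × n → ZMod 2) → ZMod 2) := Matrix.of fun i j B => q B i j
  have hgen : IsNilCleanElem
      (Matrix.of fun i j B => B (i, j) : Matrix n n ((n × n → ZMod 2) → ZMod 2)) := by
    refine ⟨e', q', ?_, ⟨∑ B, k B, ?_⟩, ?_⟩
    · ext i j B
      simpa [e', Matrix.mul_apply] using congrFun (congrFun (he B) i) j
    · ext i j B
      have hB : (Pi.evalRingHom (fun _ => ZMod 2) B).mapMatrix (q' ^ ∑ B, k B) = 0 := by
        rw [map_pow]
        exact pow_eq_zero_of_le (Finset.single_le_sum (fun _ _ => Nat.zero_le _)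
          (Finset.mem_univ B)) (hk B)
      exact congrFun (congrFun hB i) j
    · ext i j B
      exact congrFun (congrFun (h B) i) j
  convert hgen.map ψ.mapMatrix
  ext i j
  exact (hψ (i, j)).symm

theorem matrix_reduced_isGWNC_iff_boolean {R : Type*} [Ring R] [IsReduced R]
    {n : ℕ} (hn : 3 ≤ n) :
    IsGWNCRing (Matrix (Fin n) (Fin n) R) ↔ ∀ a : R, IsIdempotentElem a := by
  refine ⟨fun h => ?_, fun h A _ => ?_⟩
  · have h01 : (⟨0, by omega⟩ : Fin n) ≠ ⟨1, by omega⟩ := by simp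
    have h02 : (⟨0, by omega⟩ : Fin n) ≠ ⟨2, by omega⟩ := by simp
    have h12 : (⟨1, by omega⟩ : Fin n) ≠ ⟨2, by omega⟩ := by simp
    exact isIdempotentElem_of_isGWNCRing_matrix h01 h02 h12 h
  · let _ : BooleanRing R := { ‹Ring R› with isIdempotentElem := h }
    exact (BooleanRing.isNilCleanElem_matrix A).isWeaklyNilCleanElem
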